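/- arXiv:2108.11181 — 9 statements merged into one kernel-verified Lean document; each statement's English description precedes it below -/
import Mathlib

section
/- The collection C_* of all even-intersecting subsets of V is closed under symmetric difference (for S, T ∈ C_* one has S ∆ T ∈ C_*), and it has exactly 2048 = 2¹¹ elements. -/
/-- `V` is the 4-dimensional vector space over `𝔽₂`. -/
abbrev V : Type := Fin 4 → ZMod 2

/-- An affine hyperplane in `V`: a level set `{x | φ x = c}` of a nonzero linear
functional `φ` (equivalently, a coset of a 3-dimensional linear subspace). -/
def IsAffineHyperplane (H : Set V) : Prop :=
  ∃ (φ : V →ₗ[ZMod 2] ZMod 2) (c : ZMod 2), φ ≠ 0 ∧ H = {x | φ x = c}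

/-- `S ⊆ V` is even-intersecting if `|S ∩ ω|` is even for every affine hyperplane `ω`. -/
def EvenIntersecting (S : Set V) : Prop :=
  ∀ H : Set V, IsAffineHyperplane H → Even (S ∩ H).ncard

/-- The indicator function of a subset of `V`, with values in `𝔽₂`. -/
noncomputable def indicatorF2 (S : Set V) : V → ZMod 2 := S.indicator 1

/-- The linear map sending `f : V → 𝔽₂` to its total mass and its first moment. -/
noncomputable def massMoment : (V → ZMod 2) →ₗ[ZMod 2] ZMod 2 × V :=
  (∑ x, LinearMap.proj x).prod (∑ x, (LinearMap.proj x).smulRight x)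

theorem massMoment_apply (f : V → ZMod 2) :
    massMoment f = (∑ x, f x, ∑ x, f x • x) := by
  simp [massMoment]

theorem indicatorF2_symmDiff (S T : Set V) :
    indicatorF2 (symmDiff S T) = indicatorF2 S + indicatorF2 T := by
  funext x
  by_cases hS : x ∈ S <;> by_cases hT : x ∈ T <;>
    simp [indicatorF2, Set.mem_symmDiff, hS, hT, CharTwo.add_self_eq_zero]

theorem indicatorF2_bijective : Function.Bijective indicatorF2 := by
  constructor
  · intro S T h
    ext x
    have := congrFun h x
    by_cases hS : x ∈ S <;> by_cases hT : x ∈ T <;> simp_all [indicatorF2]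
  · intro f
    refine ⟨{x | f x = 1}, ?_⟩
    funext x
    have h : ∀ a : ZMod 2, a = 0 ∨ a = 1 := by decide
    rcases h (f x) with hx | hx <;> simp [indicatorF2, hx]

theorem ncard_cast_eq_sum_indicatorF2 (S : Set V) :
    (S.ncard : ZMod 2) = ∑ x, indicatorF2 S x := by
  classical
  simp [indicatorF2, Set.indicator_apply, Set.ncard_eq_toFinset_card', Set.toFinset]

theorem indicatorF2_inter_levelSet (S : Set V) (φ : V →ₗ[ZMod 2] ZMod 2) (c : ZMod 2) (x : V) :
    indicatorF2 (S ∩ {x | φ x = c}) x = indicatorF2 S x * φ x + (c + 1) * indicatorF2 S x := by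
  have h : ∀ a b : ZMod 2, (if a = b then (1 : ZMod 2) else 0) = a + (b + 1) := by decide
  classical
  by_cases hS : x ∈ S <;> simp [indicatorF2, Set.indicator_apply, hS, h]

theorem ncard_inter_levelSet_cast (S : Set V) (φ : V →ₗ[ZMod 2] ZMod 2) (c : ZMod 2) :
    ((S ∩ {x | φ x = c}).ncard : ZMod 2) =
      φ (massMoment (indicatorF2 S)).2 + (c + 1) * (massMoment (indicatorF2 S)).1 := by
  simp only [ncard_cast_eq_sum_indicatorF2, indicatorF2_inter_levelSet, massMoment_apply,
    map_sum, map_smul, smul_eq_mul, Finset.mul_sum, Finset.sum_add_distrib]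

theorem evenIntersecting_iff_massMoment_eq_zero (S : Set V) :
    EvenIntersecting S ↔ massMoment (indicatorF2 S) = 0 := by
  constructor
  · intro h
    have key (i : Fin 4) (c : ZMod 2) :
        (massMoment (indicatorF2 S)).2 i + (c + 1) * (massMoment (indicatorF2 S)).1 = 0 := by
      have hφ : (LinearMap.proj i : V →ₗ[ZMod 2] ZMod 2) ≠ 0 := fun h0 => by
        simpa using LinearMap.congr_fun h0 (1 : V)
      have := ncard_inter_levelSet_cast S (LinearMap.proj i) c
      rwa [(ZMod.natCast_eq_zero_iff_even).2 (h _ ⟨_, c, hφ, rfl⟩), eq_comm] at this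
    have h2 (i : Fin 4) : (massMoment (indicatorF2 S)).2 i = 0 := by
      simpa [CharTwo.add_self_eq_zero] using key i 1
    refine Prod.ext ?_ (funext h2)
    simpa [h2 0] using key 0 0
  · rintro h _ ⟨φ, c, -, rfl⟩
    rw [← ZMod.natCast_eq_zero_iff_even, ncard_inter_levelSet_cast, h]
    simp

theorem massMoment_surjective : Function.Surjective massMoment := by
  rintro ⟨n, m⟩
  refine ⟨Pi.single m 1 + Pi.single 0 (n + 1), ?_⟩
  have h : (1 : ZMod 2) + (n + 1) = n := by
    rw [add_left_comm, CharTwo.add_self_eq_zero, add_zero]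
  simp [massMoment_apply, Finset.sum_add_distrib, add_smul, Pi.single_apply, ite_smul, h]

theorem card_ker_massMoment : Nat.card (LinearMap.ker massMoment) = 2048 := by
  have h := LinearMap.finrank_range_add_finrank_ker massMoment
  rw [LinearMap.range_eq_top.2 massMoment_surjective, finrank_top] at h
  have h' : Module.finrank (ZMod 2) (LinearMap.ker massMoment) = 11 := by
    simp at h
    omega
  rw [Module.natCard_eq_pow_finrank (K := ZMod 2), h']
  simp

/-- the collection `C_*` of even-intersecting subsets is closed under
symmetric difference and has exactly `2048 = 2¹¹` elements. -/
theorem evenIntersecting_closed_and_card :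
    (∀ S T : Set V, EvenIntersecting S → EvenIntersecting T →
      EvenIntersecting (symmDiff S T)) ∧
    {S : Set V | EvenIntersecting S}.ncard = 2048 := by
  refine ⟨fun S T hS hT => ?_, ?_⟩
  · rw [evenIntersecting_iff_massMoment_eq_zero] at *
    rw [indicatorF2_symmDiff, map_add, hS, hT, add_zero]
  · have h : {S : Set V | EvenIntersecting S} =
        indicatorF2 ⁻¹' (LinearMap.ker massMoment : Set (V → ZMod 2)) := by
      ext S
      simp [evenIntersecting_iff_massMoment_eq_zero]
    rw [h, Set.ncard_preimage_of_injective_subset_range indicatorF2_bijective.injective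
      (by simp [indicatorF2_bijective.surjective.range_eq])]
    exact card_ker_massMoment
end

section
/- If S ⊆ V is an even-intersecting subset, then |S| ∈ {0, 4, 6, 8, 10, 12, 16}. Equivalently, C_n = ∅ whenever n is odd or n ∈ {2, 14}. -/
lemma isAffineHyperplane_coord (i : Fin 4) (c : ZMod 2) : IsAffineHyperplane {x : V | x i = c} := by
  refine ⟨LinearMap.proj i, c, fun h => ?_, rfl⟩
  simpa using LinearMap.congr_fun h (Pi.single i 1)

lemma ncard_coord_hyperplane (i : Fin 4) (c : ZMod 2) : {x : V | x i = c}.ncard = 8 := by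
  rw [Set.ncard_eq_toFinset_card', Set.toFinset_ofPred]
  revert i c
  decide

/-- A pair of points is separated by some coordinate hyperplane. -/
lemma ncard_ne_two_of_even_coord {S : Set V}
    (h : ∀ (i : Fin 4) (c : ZMod 2), Even (S ∩ {x | x i = c}).ncard) : S.ncard ≠ 2 := by
  intro hS
  obtain ⟨a, b, hab, rfl⟩ := Set.ncard_eq_two.mp hS
  obtain ⟨i, hi⟩ := Function.ne_iff.mp hab
  have hsingle : ({a, b} : Set V) ∩ {x | x i = a i} = {a} := by
    ext x
    simp only [Set.mem_inter_iff, Set.mem_insert_iff, Set.mem_singleton_iff, Set.mem_ofPred_eq]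
    constructor
    · rintro ⟨rfl | rfl, hx⟩
      · rfl
      · exact absurd hx.symm hi
    · rintro rfl
      exact ⟨Or.inl rfl, rfl⟩
  simpa [hsingle] using h i (a i)

lemma even_ncard_of_even_coord {S : Set V}
    (h : ∀ (i : Fin 4) (c : ZMod 2), Even (S ∩ {x | x i = c}).ncard) : Even S.ncard := by
  have hdiff : S \ {x | x 0 = 0} = S ∩ {x | x 0 = 1} := by
    ext x
    have hzmod : ∀ c : ZMod 2, c ≠ 0 ↔ c = 1 := by decide
    simp only [Set.mem_sdiff, Set.mem_inter_iff, Set.mem_ofPred_eq, ← hzmod, ne_eq]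
  rw [← Set.ncard_inter_add_ncard_sdiff_eq_ncard S {x | x 0 = 0}, hdiff]
  exact (h 0 0).add (h 0 1)

lemma even_coord_compl {S : Set V}
    (h : ∀ (i : Fin 4) (c : ZMod 2), Even (S ∩ {x | x i = c}).ncard) (i : Fin 4) (c : ZMod 2) :
    Even (Sᶜ ∩ {x | x i = c}).ncard := by
  have hsum := Set.ncard_inter_add_ncard_sdiff_eq_ncard {x : V | x i = c} S
  rw [ncard_coord_hyperplane, Set.inter_comm, Set.sdiff_eq, Set.inter_comm _ Sᶜ] at hsum
  have := h i c
  grind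

/-- an even-intersecting subset has cardinality in `{0,4,6,8,10,12,16}`. -/
theorem evenIntersecting_card_mem :
    ∀ S : Set V, EvenIntersecting S →
      S.ncard ∈ ({0, 4, 6, 8, 10, 12, 16} : Set ℕ) := by
  intro S hS
  have h (i : Fin 4) (c : ZMod 2) : Even (S ∩ {x | x i = c}).ncard :=
    hS _ (isAffineHyperplane_coord i c)
  have heven := even_ncard_of_even_coord h
  have hne := ncard_ne_two_of_even_coord h
  have hne_compl := ncard_ne_two_of_even_coord (even_coord_compl h)
  have hsum := Set.ncard_add_ncard_compl S
  have hcard : Nat.card V = 16 := by simp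
  rw [hcard] at hsum
  simp only [Set.mem_insert_iff, Set.mem_singleton_iff]
  obtain ⟨k, hk⟩ := heven
  omega
end

section
/- A 4-element subset S ⊆ V is even-intersecting if and only if S is an affine plane, i.e., a coset of a 2-dimensional 𝔽₂-linear subspace of V. Consequently |C₄| = 140. -/
/-- An affine plane in `V`: a coset `a + W` of a 2-dimensional linear subspace `W`. -/
def IsAffinePlane (S : Set V) : Prop :=
  ∃ (W : Submodule (ZMod 2) V) (a : V),
    Module.finrank (ZMod 2) W = 2 ∧ S = (fun x => a + x) '' (W : Set V)

theorem zmodTwo_sum_eq_card (S : Finset V) (φ : V →ₗ[ZMod 2] ZMod 2) :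
    φ (∑ x ∈ S, x) = ((S.filter fun x => φ x = 1).card : ZMod 2) := by
  rw [map_sum, Finset.card_filter, Nat.cast_sum]
  refine Finset.sum_congr rfl fun x _ => ?_
  generalize φ x = t
  revert t
  decide

theorem ncard_inter_levelSet (S : Finset V) (φ : V →ₗ[ZMod 2] ZMod 2) (c : ZMod 2) :
    ((S : Set V) ∩ {x | φ x = c}).ncard = (S.filter fun x => φ x = c).card := by
  rw [← Set.ncard_coe_finset]
  congr 1
  ext x
  simp

theorem evenIntersecting_coe_iff_sum_eq_zero {S : Finset V} (hS : Even S.card) :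
    EvenIntersecting (S : Set V) ↔ ∑ x ∈ S, x = 0 := by
  constructor
  · intro h
    refine (Module.forall_dual_apply_eq_zero_iff (ZMod 2) _).mp fun φ => ?_
    rcases eq_or_ne φ 0 with rfl | hφ
    · rfl
    · rw [zmodTwo_sum_eq_card, ZMod.natCast_eq_zero_iff_even, ← ncard_inter_levelSet]
      exact h _ ⟨φ, 1, hφ, rfl⟩
  · rintro h H ⟨φ, c, -, rfl⟩
    rw [ncard_inter_levelSet]
    have h1 : Even (S.filter fun x => φ x = 1).card := by
      rw [← ZMod.natCast_eq_zero_iff_even, ← zmodTwo_sum_eq_card, h, map_zero]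
    have hc : c = 1 ∨ c = 0 := by revert c; decide
    rcases hc with rfl | rfl
    · exact h1
    · have h2 := Finset.card_filter_add_card_filter_not (s := S) (fun x => φ x = 1)
      have h3 : (S.filter fun x => ¬ φ x = 1) = S.filter fun x => φ x = 0 := by
        refine Finset.filter_congr fun x _ => ?_
        generalize φ x = t
        revert t
        decide
      rw [h3] at h2
      rw [← h2] at hS
      exact (Nat.even_add.mp hS).mp h1

theorem mem_span_pair_zmodTwo {u v x : V} :
    x ∈ Submodule.span (ZMod 2) {u, v} ↔ x = 0 ∨ x = u ∨ x = v ∨ x = u + v := by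
  rw [Submodule.mem_span_pair]
  constructor
  · rintro ⟨s, t, rfl⟩
    have hs : ∀ s : ZMod 2, s = 0 ∨ s = 1 := by decide
    rcases hs s with rfl | rfl <;> rcases hs t with rfl | rfl <;> simp
  · rintro (rfl | rfl | rfl | rfl)
    exacts [⟨0, 0, by simp⟩, ⟨1, 0, by simp⟩, ⟨0, 1, by simp⟩, ⟨1, 1, by simp⟩]

theorem linearIndependent_pair_zmodTwo {u v : V} (hu : u ≠ 0) (hv : v ≠ 0) (huv : u ≠ v) :
    LinearIndependent (ZMod 2) ![u, v] := by
  rw [LinearIndependent.pair_iff]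
  intro s t h
  have hs : ∀ s : ZMod 2, s = 0 ∨ s = 1 := by decide
  rcases hs s with rfl | rfl <;> rcases hs t with rfl | rfl <;> simp_all
  exact huv (CharTwo.add_eq_zero.mp h)

theorem isAffinePlane_coe_iff_sum_eq_zero {S : Finset V} (hS : S.card = 4) :
    IsAffinePlane (S : Set V) ↔ ∑ x ∈ S, x = 0 := by
  constructor
  · rintro ⟨W, a, hW, hSW⟩
    obtain ⟨b⟩ : Nonempty (Module.Basis (Fin 2) (ZMod 2) W) :=
      ⟨Module.finBasisOfFinrankEq (ZMod 2) W hW⟩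
    have hspan : W = Submodule.span (ZMod 2) {(b 0 : V), (b 1 : V)} := by
      have h := congrArg (Submodule.map W.subtype) b.span_eq
      rw [Submodule.map_span, ← Set.range_comp, Submodule.map_top, Submodule.range_subtype] at h
      refine h.symm.trans ?_
      congr 1
      ext x
      simp [Fin.exists_fin_two, eq_comm]
    generalize (b 0 : V) = u at hspan
    generalize (b 1 : V) = v at hspan
    have hS' : S = {a, a + u, a + v, a + (u + v)} := by
      ext x
      rw [← Finset.mem_coe, hSW, hspan]
      simp only [Set.mem_image, SetLike.mem_coe, mem_span_pair_zmodTwo, Finset.mem_insert,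
        Finset.mem_singleton]
      constructor
      · rintro ⟨y, rfl | rfl | rfl | rfl, rfl⟩ <;> simp
      · rintro (rfl | rfl | rfl | rfl)
        exacts [⟨0, by simp⟩, ⟨u, by simp⟩, ⟨v, by simp⟩, ⟨u + v, by simp⟩]
    have hval : S.val = {a, a + u, a + v, a + (u + v)} := by
      have h : ({a, a + u, a + v, a + (u + v)} : Multiset V).toFinset = S := by
        rw [hS']
        simp
      have hnd : ({a, a + u, a + v, a + (u + v)} : Multiset V).Nodup := by
        rw [← Multiset.toFinset_card_eq_card_iff_nodup, h, hS]
        rfl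
      rw [← h, Multiset.toFinset_val, hnd.dedup]
    change (S.val.map id).sum = 0
    rw [Multiset.map_id, hval]
    have h2 : (2 : V) = 0 := CharTwo.two_eq_zero
    simp only [Multiset.insert_eq_cons, Multiset.sum_cons, Multiset.sum_singleton]
    linear_combination (2 * a + u + v) * h2
  · intro h
    obtain ⟨a, b, c, d, hab, hac, had, hbc, hbd, hcd, rfl⟩ := Finset.card_eq_four.mp hS
    rw [Finset.sum_insert (by simp [*]), Finset.sum_insert (by simp [*]),
      Finset.sum_insert (by simp [*]), Finset.sum_singleton] at h
    have key : ∀ x y : V, x + (x + y) = y := fun x y => CharTwo.add_cancel_left x y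
    have hd : d = a + ((a + b) + (a + c)) := by
      have h2 : (2 : V) = 0 := CharTwo.two_eq_zero
      linear_combination h - (2 * a + b + c) * h2
    refine ⟨Submodule.span (ZMod 2) {a + b, a + c}, a, ?_, ?_⟩
    · have hli := linearIndependent_pair_zmodTwo (u := a + b) (v := a + c)
        (mt CharTwo.add_eq_zero.mp hab) (mt CharTwo.add_eq_zero.mp hac) (by simpa using hbc)
      have hrange : Set.range ![a + b, a + c] = {a + b, a + c} := by
        ext x
        rw [Set.mem_range, Fin.exists_fin_two]
        simp [eq_comm]
      rw [← hrange, finrank_span_eq_card hli, Fintype.card_fin]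
    · ext x
      simp only [Set.mem_image, SetLike.mem_coe, mem_span_pair_zmodTwo, Finset.coe_insert,
        Finset.coe_singleton, Set.mem_insert_iff, Set.mem_singleton_iff]
      constructor
      · rintro (rfl | rfl | rfl | rfl)
        exacts [⟨0, by simp⟩, ⟨a + x, by simp [key]⟩, ⟨a + x, by simp [key]⟩, ⟨_, by simp, hd.symm⟩]
      · rintro ⟨y, rfl | rfl | rfl | rfl, rfl⟩ <;> simp [key, hd]

theorem card_sum_eq_zero_mul_four :
    ((Finset.powersetCard 4 (Finset.univ : Finset V)).filter fun S => ∑ x ∈ S, x = 0).card * 4 =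
      560 * 1 := by
  have h560 : (Finset.powersetCard 3 (Finset.univ : Finset V)).card = 560 := by
    rw [Finset.card_powersetCard, Finset.card_univ, Fintype.card_fun, ZMod.card, Fintype.card_fin]
    rfl
  rw [← h560]
  refine Finset.card_mul_eq_card_mul (fun S T => T ⊆ S) (fun S hS => ?_) fun T hT => ?_
  · have hS4 : S.card = 4 := by
      simpa using (Finset.mem_filter.mp hS).1
    have h : Finset.bipartiteAbove (fun S T : Finset V => T ⊆ S)
        (Finset.powersetCard 3 Finset.univ) S = Finset.powersetCard 3 S := by
      ext T
      simp [Finset.bipartiteAbove, Finset.mem_powersetCard, and_comm]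
    rw [h, Finset.card_powersetCard, hS4]
    rfl
  · have hT3 : T.card = 3 := by simpa using hT
    have hsum : ∑ x ∈ T, x ∉ T := by
      obtain ⟨a, b, c, hab, hac, hbc, rfl⟩ := Finset.card_eq_three.mp hT3
      rw [Finset.sum_insert (by simp [*]), Finset.sum_insert (by simp [*]), Finset.sum_singleton]
      have hsum : ∀ x y z : V, x + (y + z) = x → y = z := fun x y z h =>
        CharTwo.add_eq_zero.mp (add_eq_left.mp h)
      simp only [Finset.mem_insert, Finset.mem_singleton, not_or]
      exact ⟨fun h => hbc (hsum a b c h), fun h => hac (hsum b a c ((add_left_comm b a c).trans h)),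
        fun h => hab (hsum c a b (by rw [add_comm, add_assoc, h]))⟩
    rw [Finset.card_eq_one]
    refine ⟨insert (∑ x ∈ T, x) T, ?_⟩
    ext S
    simp only [Finset.bipartiteBelow, Finset.mem_filter, Finset.mem_powersetCard,
      Finset.subset_univ, true_and, Finset.mem_singleton]
    constructor
    · rintro ⟨⟨hS4, hS0⟩, hTS⟩
      obtain ⟨y, hy, rfl⟩ : ∃ y ∉ T, insert y T = S :=
        (Finset.exists_eq_insert_iff (s := T) (t := S)).mpr ⟨hTS, by omega⟩
      rw [Finset.sum_insert hy] at hS0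
      rw [CharTwo.add_eq_zero.mp hS0]
    · rintro rfl
      refine ⟨⟨?_, ?_⟩, Finset.subset_insert _ _⟩
      · rw [Finset.card_insert_of_notMem hsum, hT3]
      · rw [Finset.sum_insert hsum, CharTwo.add_self_eq_zero]

/-- a 4-element subset is even-intersecting iff it is an affine plane;
consequently `|C₄| = 140`. -/
theorem evenIntersecting_card_four :
    (∀ S : Set V, S.ncard = 4 → (EvenIntersecting S ↔ IsAffinePlane S)) ∧
    {S : Set V | EvenIntersecting S ∧ S.ncard = 4}.ncard = 140 := by
  refine ⟨fun S hS => ?_, ?_⟩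
  · lift S to Finset V using S.toFinite
    rw [Set.ncard_coe_finset] at hS
    rw [evenIntersecting_coe_iff_sum_eq_zero (hS ▸ by decide),
      isAffinePlane_coe_iff_sum_eq_zero hS]
  · have h : {S : Set V | EvenIntersecting S ∧ S.ncard = 4} = (fun S : Finset V => (S : Set V)) ''
        ((Finset.powersetCard 4 (Finset.univ : Finset V)).filter fun S => ∑ x ∈ S, x = 0 :
          Finset (Finset V)) := by
      ext S
      lift S to Finset V using S.toFinite
      simp only [Set.mem_ofPred_eq, Set.ncard_coe_finset, Set.mem_image, Finset.coe_inj,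
        exists_eq_right, Finset.coe_filter, Finset.mem_powersetCard, Finset.subset_univ, true_and]
      rw [and_comm]
      exact and_congr_right fun hS => evenIntersecting_coe_iff_sum_eq_zero (hS ▸ by decide)
    rw [h, Set.ncard_image_of_injective _ Finset.coe_injective, Set.ncard_coe_finset]
    have := card_sum_eq_zero_mul_four
    omega
end

section
/- A bijection g : V → V maps every affine hyperplane of V onto an affine hyperplane if and only if g is an affine transformation, i.e., g(x) = f(x) + b for some 𝔽₂-linear automorphism f of V and some b ∈ V. Consequently, the setwise stabilizer of the collection of affine hyperplanes in the symmetric group of V is the affine group AGL(4, 𝔽₂), of order 322560. -/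
theorem ZMod.two_eq_add_of_eq_iff_eq :
    ∀ {a b c d : ZMod 2}, (a = c ↔ b = d) → a = b + (c + d) := by
  decide

/-- A permutation of `V` preserving affine hyperplanes pulls nonzero functionals back along its
inverse to affine functions. -/
theorem exists_functional_add_const {g : Equiv.Perm V}
    (hg : ∀ H : Set V, IsAffineHyperplane H → IsAffineHyperplane (g '' H))
    {φ : V →ₗ[ZMod 2] ZMod 2} (hφ : φ ≠ 0) :
    ∃ (ψ : V →ₗ[ZMod 2] ZMod 2) (e : ZMod 2), ∀ y, φ (g.symm y) = ψ y + e := by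
  obtain ⟨ψ, d, -, h⟩ := hg {x | φ x = 0} ⟨φ, 0, hφ, rfl⟩
  refine ⟨ψ, 0 + d, fun y => ZMod.two_eq_add_of_eq_iff_eq ?_⟩
  rw [Equiv.image_eq_preimage_symm] at h
  exact Set.ext_iff.mp h y

theorem exists_linearEquiv_add_of_preserves {g : Equiv.Perm V}
    (hg : ∀ H : Set V, IsAffineHyperplane H → IsAffineHyperplane (g '' H)) :
    ∃ (f : V ≃ₗ[ZMod 2] V) (b : V), ∀ x, g x = f x + b := by
  have hproj (i : Fin 4) : (LinearMap.proj i : V →ₗ[ZMod 2] ZMod 2) ≠ 0 := fun h => by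
    simpa using LinearMap.congr_fun h (fun _ => 1)
  choose ψ e hψ using fun i => exists_functional_add_const hg (hproj i)
  have hsymm (y : V) : g.symm y = LinearMap.pi ψ y + e := funext fun i => hψ i y
  have hbij : Function.Bijective (LinearMap.pi ψ) := by
    have : ⇑(LinearMap.pi ψ) = g.symm.trans (Equiv.subRight e) := by
      ext1 y
      simp [hsymm]
    rw [this]
    exact Equiv.bijective _
  let L := LinearEquiv.ofBijective (LinearMap.pi ψ) hbij
  refine ⟨L.symm, -L.symm e, fun x => L.injective ?_⟩
  have hx : x = L (g x) + e := (g.symm_apply_apply x).symm.trans (hsymm (g x))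
  rw [map_add, map_neg, L.apply_symm_apply, L.apply_symm_apply]
  exact eq_add_neg_of_add_eq hx.symm

theorem IsAffineHyperplane.image_linearEquiv_add {H : Set V} (hH : IsAffineHyperplane H)
    (f : V ≃ₗ[ZMod 2] V) (b : V) : IsAffineHyperplane ((fun x => f x + b) '' H) := by
  obtain ⟨φ, c, hφ, rfl⟩ := hH
  refine ⟨φ ∘ₗ f.symm, c + φ (f.symm b), fun h => hφ ?_, ?_⟩
  · refine LinearMap.ext fun x => ?_
    simpa using LinearMap.congr_fun h (f x)
  · ext y
    constructor
    · rintro ⟨x, hx, rfl⟩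
      simpa using hx
    · intro hy
      refine ⟨f.symm (y - b), ?_, by simp⟩
      simpa [sub_eq_iff_eq_add] using hy

theorem preserves_iff_exists_linearEquiv_add (g : Equiv.Perm V) :
    (∀ H : Set V, IsAffineHyperplane H → IsAffineHyperplane (g '' H)) ↔
      ∃ (f : V ≃ₗ[ZMod 2] V) (b : V), ∀ x, g x = f x + b := by
  refine ⟨exists_linearEquiv_add_of_preserves, ?_⟩
  rintro ⟨f, b, h⟩ H hH
  rw [funext h]
  exact hH.image_linearEquiv_add f b

theorem card_linearEquiv : Nat.card (V ≃ₗ[ZMod 2] V) = 20160 := by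
  rw [← Nat.card_congr (Matrix.GeneralLinearGroup.toLin.trans
    (LinearMap.GeneralLinearGroup.generalLinearEquiv (ZMod 2) V)).toEquiv, Matrix.card_GL_field]
  simp [Fin.prod_univ_succ]

/-- The affine permutation `x ↦ f x + b` attached to a pair `(f, b)`. -/
def affinePerm (p : (V ≃ₗ[ZMod 2] V) × V) : Equiv.Perm V :=
  p.1.toEquiv.trans (Equiv.addRight p.2)

theorem affinePerm_apply (p : (V ≃ₗ[ZMod 2] V) × V) (x : V) : affinePerm p x = p.1 x + p.2 := rfl

theorem affinePerm_injective : Function.Injective affinePerm := by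
  rintro ⟨f, b⟩ ⟨f', b'⟩ h
  have h (x : V) : f x + b = f' x + b' := Equiv.congr_fun h x
  obtain rfl : b = b' := by simpa using h 0
  exact Prod.ext (LinearEquiv.ext fun x => add_right_cancel (h x)) rfl

theorem range_affinePerm : Set.range affinePerm =
    {g : Equiv.Perm V | ∀ H : Set V, IsAffineHyperplane H → IsAffineHyperplane (g '' H)} := by
  ext g
  rw [Set.mem_ofPred_eq, preserves_iff_exists_linearEquiv_add]
  simp only [Set.mem_range, Prod.exists, Equiv.ext_iff, affinePerm_apply, eq_comm]

/-- a bijection `g : V → V` maps affine hyperplanes onto affine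
hyperplanes iff it is an affine transformation `x ↦ f x + b`; consequently the
setwise stabilizer of the collection of affine hyperplanes in the symmetric group
of `V` has order `322560 = |AGL(4, 𝔽₂)|`. -/
theorem affine_stabilizer :
    (∀ g : V → V, Function.Bijective g →
      ((∀ H : Set V, IsAffineHyperplane H → IsAffineHyperplane (g '' H)) ↔
        ∃ (f : V ≃ₗ[ZMod 2] V) (b : V), ∀ x, g x = f x + b)) ∧
    Nat.card {g : Equiv.Perm V //
      ∀ H : Set V, IsAffineHyperplane H → IsAffineHyperplane (g '' H)} = 322560 := by
  refine ⟨fun g hg => preserves_iff_exists_linearEquiv_add (Equiv.ofBijective g hg), ?_⟩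
  calc
    _ = Nat.card (Set.range affinePerm) := by rw [range_affinePerm]; rfl
    _ = Nat.card ((V ≃ₗ[ZMod 2] V) × V) := Nat.card_range_of_injective affinePerm_injective
    _ = 322560 := by simp [Nat.card_prod, card_linearEquiv]
end

section
/- Let g : V → V be a bijection that maps every affine hyperplane of V onto an affine hyperplane. Then the following are equivalent: (i) for every even-intersecting subset S ⊆ V, the symmetric difference g(S) ∆ S belongs to O_* = {∅} ∪ O₈ ∪ {V}; (ii) g is a translation x ↦ x + t for some t ∈ V. In particular, the set of such bijections forms a group isomorphic to (ℤ/2)⁴ acting simply transitively on V. -/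
/-- `O_* = {∅} ∪ O₈ ∪ {V}`. -/
def Ostar : Set (Set V) :=
  {∅} ∪ {H | IsAffineHyperplane H} ∪ {Set.univ}

/-- The combined property: `g` maps affine hyperplanes onto affine hyperplanes, and
`g(S) ∆ S ∈ O_*` for every even-intersecting `S`. -/
def IsKummerTranslation (g : Equiv.Perm V) : Prop :=
  (∀ H : Set V, IsAffineHyperplane H → IsAffineHyperplane (g '' H)) ∧
  (∀ S : Set V, EvenIntersecting S → symmDiff (g '' S) S ∈ Ostar)

lemma ite_eq_add_add_one :
    ∀ u c : ZMod 2, (if u = c then (1 : ZMod 2) else 0) = u + c + 1 := by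
  decide

open Finset in
lemma natCast_ncard_inter_level (S : Set V) [DecidablePred (· ∈ S)]
    (φ : V →ₗ[ZMod 2] ZMod 2) (c : ZMod 2) :
    ((S ∩ {x | φ x = c}).ncard : ZMod 2) = ∑ x, if x ∈ S then φ x + c + 1 else 0 := by
  have h : S ∩ {x | φ x = c} = ((univ.filter fun x => x ∈ S ∧ φ x = c : Finset V) : Set V) := by
    ext x; simp
  rw [h, Set.ncard_coe_finset, Finset.card_filter]
  push_cast
  refine sum_congr rfl fun x _ => ?_
  by_cases hx : x ∈ S
  · simp [hx, ite_eq_add_add_one]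
  · simp [hx]

lemma ncard_level {φ : V →ₗ[ZMod 2] ZMod 2} (hφ : φ ≠ 0) (c : ZMod 2) :
    {x | φ x = c}.ncard = 8 := by
  obtain ⟨v, hv⟩ := LinearMap.surjective hφ c
  have hker : Nat.card (LinearMap.ker φ) = 8 := by
    have h := Module.Dual.finrank_ker_add_one_of_ne_zero (f := φ) hφ
    rw [Module.finrank_fin_fun] at h
    rw [Module.natCard_eq_pow_finrank (K := ZMod 2), Nat.card_zmod,
      show Module.finrank (ZMod 2) (LinearMap.ker φ) = 3 by omega]
    rfl
  have himg : {x | φ x = c} = (fun x => x + v) '' (LinearMap.ker φ : Set V) := by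
    ext x
    constructor
    · intro hx
      refine ⟨x - v, ?_, by simp⟩
      replace hx : φ x = c := hx
      simp [hx, hv]
    · rintro ⟨y, hy, rfl⟩
      have : φ y = 0 := hy
      simp [this, hv]
  rw [himg, Set.ncard_image_of_injective _ (add_left_injective v), ← Nat.card_coe_set_eq]
  exact hker

lemma sum_zmod_two {M : Type*} [AddCommMonoid M] (F : ZMod 2 → M) : ∑ i, F i = F 0 + F 1 :=
  Fin.sum_univ_two F

lemma sum_fin_three_pi {α M : Type*} [Fintype α] [AddCommMonoid M] (F : (Fin 3 → α) → M) :
    ∑ c, F c = ∑ i, ∑ j, ∑ k, F ![i, j, k] := by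
  let e : α × α × α ≃ (Fin 3 → α) :=
    { toFun := fun p => ![p.1, p.2.1, p.2.2]
      invFun := fun c => (c 0, c 1, c 2)
      left_inv := fun _ => rfl
      right_inv := fun c => by ext i; fin_cases i <;> rfl }
  rw [← e.sum_comp, Fintype.sum_prod_type]
  simp only [Fintype.sum_prod_type]
  rfl

/-- The sum of the indicator function of an even-intersecting set over a (possibly degenerate)
parametrized 3-dimensional affine subspace vanishes. -/
lemma EvenIntersecting.sum_comb_eq_zero {S : Set V} [DecidablePred (· ∈ S)]
    (hS : EvenIntersecting S) (v : Fin 3 → V) (x : V) :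
    ∑ c : Fin 3 → ZMod 2, (if x + Fintype.linearCombination (ZMod 2) v c ∈ S
      then (1 : ZMod 2) else 0) = 0 := by
  classical
  by_cases hv : LinearIndependent (ZMod 2) v
  · have hinj : Function.Injective fun c => x + Fintype.linearCombination (ZMod 2) v c :=
      (add_right_injective x).comp (linearIndependent_iff_injective_fintypeLinearCombination.mp hv)
    obtain ⟨φ, hφ, hφv⟩ : ∃ φ : V →ₗ[ZMod 2] ZMod 2, φ ≠ 0 ∧
        Submodule.span (ZMod 2) (Set.range v) ≤ LinearMap.ker φ := by
      refine Submodule.exists_le_ker_of_lt_top _ (lt_top_iff_ne_top.mpr fun htop => ?_)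
      have h := finrank_span_eq_card hv
      rw [htop, finrank_top, Module.finrank_fin_fun] at h
      simp at h
    have hmem : ∀ c, φ (x + Fintype.linearCombination (ZMod 2) v c) = φ x := by
      intro c
      have : Fintype.linearCombination (ZMod 2) v c ∈ LinearMap.ker φ := by
        apply hφv
        rw [← Fintype.range_linearCombination (ZMod 2)]
        exact LinearMap.mem_range_self _ c
      rw [map_add, LinearMap.mem_ker.mp this, add_zero]
    have himg : Finset.univ.image (fun c => x + Fintype.linearCombination (ZMod 2) v c) =
        Finset.univ.filter fun y => φ y = φ x := by
      apply Finset.eq_of_subset_of_card_le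
      · intro y hy
        obtain ⟨c, -, rfl⟩ := Finset.mem_image.mp hy
        simpa using hmem c
      · rw [Finset.card_image_of_injective _ hinj]
        have h := ncard_level hφ (φ x)
        rw [← Finset.coe_filter_univ, Set.ncard_coe_finset] at h
        simp [h]
    have h := hS _ ⟨φ, φ x, hφ, rfl⟩
    rw [← ZMod.natCast_eq_zero_iff_even, natCast_ncard_inter_level] at h
    rw [← Finset.sum_image (f := fun y => if y ∈ S then (1 : ZMod 2) else 0)
      (g := fun c => x + Fintype.linearCombination (ZMod 2) v c) hinj.injOn, himg,
      Finset.sum_filter]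
    refine Eq.trans ?_ h
    refine Finset.sum_congr rfl fun y _ => ?_
    by_cases hy : y ∈ S
    · simp [hy, ite_eq_add_add_one]
    · simp [hy]
  · rw [linearIndependent_iff_injective_fintypeLinearCombination, injective_iff_map_eq_zero] at hv
    push Not at hv
    obtain ⟨k, hk, hk0⟩ := hv
    refine Finset.sum_involution (fun c _ => c + k) (fun c _ => ?_) (fun c _ _ => ?_)
      (fun c _ => Finset.mem_univ _) (fun c _ => ?_)
    · rw [map_add, hk, add_zero]
      exact ZModModule.add_self _
    · simpa using hk0
    · rw [add_assoc, ZModModule.add_self, add_zero]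

/-- A `ZMod 2`-valued function with vanishing second differences is affine, so its support
lies in `Ostar`. -/
lemma setOf_eq_one_mem_Ostar (F : V → ZMod 2)
    (hF : ∀ a b, F (a + b) + F a + F b + F 0 = 0) : {x | F x = 1} ∈ Ostar := by
  let ψ : V →+ ZMod 2 := AddMonoidHom.mk' (fun x => F x + F 0) fun a b => by
    have key : ∀ p q r s : ZMod 2, p + q + r + s = 0 → p + s = q + s + (r + s) := by decide
    exact key _ _ _ _ (hF a b)
  let φ : V →ₗ[ZMod 2] ZMod 2 := ψ.toZModLinearMap 2
  have hφ : ∀ x, φ x = F x + F 0 := fun x => rfl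
  by_cases h : φ = 0
  · have hc : ∀ x, F x = F 0 := by
      intro x
      have h1 : F x + F 0 = 0 := by rw [← hφ, h, LinearMap.zero_apply]
      have key : ∀ p q : ZMod 2, p + q = 0 → p = q := by decide
      exact key _ _ h1
    by_cases h0 : F 0 = 1
    · right
      ext x; simp [hc x, h0]
    · left; left
      ext x; simp [hc x, h0]
  · left; right
    refine ⟨φ, 1 + F 0, h, ?_⟩
    ext x
    simp [hφ]

lemma image_add_const_eq (S : Set V) (t : V) : (fun x => x + t) '' S = {x | x + t ∈ S} := by
  ext x
  constructor
  · rintro ⟨y, hy, rfl⟩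
    simpa [add_assoc, ZModModule.add_self] using hy
  · exact fun hx => ⟨x + t, hx, by simp [add_assoc, ZModModule.add_self]⟩

lemma EvenIntersecting.symmDiff_translate_mem_Ostar {S : Set V} (hS : EvenIntersecting S)
    (t : V) : symmDiff ((fun x => x + t) '' S) S ∈ Ostar := by
  classical
  let f : V → ZMod 2 := fun x => if x ∈ S then 1 else 0
  have hset : symmDiff ((fun x => x + t) '' S) S = {x | f (x + t) + f x = 1} := by
    rw [image_add_const_eq]
    ext x
    by_cases h1 : x + t ∈ S <;> by_cases h2 : x ∈ S <;>
      simp [Set.mem_symmDiff, f, h1, h2, CharTwo.add_self_eq_zero]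
  rw [hset]
  refine setOf_eq_one_mem_Ostar _ fun a b => ?_
  have h := hS.sum_comb_eq_zero ![a, b, t] 0
  change ∑ c, f (0 + Fintype.linearCombination (ZMod 2) ![a, b, t] c) = 0 at h
  simp only [sum_fin_three_pi, Fintype.linearCombination_apply, Fin.sum_univ_three,
    sum_zmod_two] at h
  simp only [Matrix.cons_val, zero_smul, one_smul, zero_add, add_zero] at h
  rw [zero_add, ← h]
  ring

open Finset in
lemma card_plane (x : V) {a b : V} (ha : a ≠ 0) (hb : b ≠ 0) (hab : a ≠ b) :
    #{x, x + a, x + b, x + (a + b)} = 4 := by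
  have hab' : a + b ≠ 0 := fun h => hab (by rwa [← ZModModule.sub_eq_add, sub_eq_zero] at h)
  rw [card_insert_of_notMem, card_insert_of_notMem, card_pair] <;>
    simp [ha, hb, hab, hab']

lemma evenIntersecting_plane (x : V) {a b : V} (ha : a ≠ 0) (hb : b ≠ 0) (hab : a ≠ b) :
    EvenIntersecting ↑({x, x + a, x + b, x + (a + b)} : Finset V) := by
  classical
  rintro _ ⟨φ, c, -, rfl⟩
  have hab' : a + b ≠ 0 := fun h => hab (by rwa [← ZModModule.sub_eq_add, sub_eq_zero] at h)
  rw [← ZMod.natCast_eq_zero_iff_even, natCast_ncard_inter_level]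
  simp only [Finset.mem_coe]
  rw [Finset.sum_ite_mem, Finset.univ_inter, Finset.sum_insert, Finset.sum_insert,
    Finset.sum_pair]
  · simp only [map_add]
    have key : ∀ p q r s : ZMod 2,
      p + s + 1 + (p + q + s + 1 + (p + r + s + 1 + (p + (q + r) + s + 1))) = 0 := by decide
    exact key _ _ _ _
  all_goals simp [ha, hb, hab, hab']

open Finset in
lemma card_symmDiff_add {α : Type*} [DecidableEq α] (s t : Finset α) :
    #(symmDiff s t) + 2 * #(s ∩ t) = #s + #t := by
  have h1 := card_sdiff_add_card_inter s t
  have h2 := card_sdiff_add_card_inter t s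
  have h3 : #(symmDiff s t) = #(s \ t) + #(t \ s) :=
    card_union_of_disjoint disjoint_sdiff_sdiff
  rw [inter_comm t s] at h2
  omega

/-- If `g(P) ∆ P ∈ O_*` for a plane `P` with direction `{0, a, b, a + b}`, then `g` preserves
that direction. -/
lemma image_plane_parallel {g : V → V} (hg : Function.Injective g) (x : V) {a b : V}
    (ha : a ≠ 0) (hb : b ≠ 0) (hab : a ≠ b)
    (h : symmDiff (g '' ↑({x, x + a, x + b, x + (a + b)} : Finset V))
      ↑({x, x + a, x + b, x + (a + b)} : Finset V) ∈ Ostar) :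
    g (x + a) = g x + a ∨ g (x + a) = g x + b ∨ g (x + a) = g x + (a + b) := by
  classical
  set P : Finset V := {x, x + a, x + b, x + (a + b)} with hP
  have hPcard : P.card = 4 := card_plane x ha hb hab
  have hQcard : (P.image g).card = 4 := by rw [Finset.card_image_of_injective _ hg, hPcard]
  have hne : g (x + a) ≠ g x := fun h => ha (by simpa using hg h)
  have hself : ∀ y : V, y + y = 0 := ZModModule.add_self
  rw [← Finset.coe_image, ← Finset.coe_symmDiff] at h
  -- it suffices that the image is a coset of the direction of `P`
  suffices hcoset : P.image g = {g x, g x + a, g x + b, g x + (a + b)} by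
    have hm : g (x + a) ∈ P.image g := Finset.mem_image_of_mem g (by simp [hP])
    simpa [hcoset, hne] using hm
  symm
  apply Finset.eq_of_subset_of_card_le _ (by rw [hQcard, card_plane _ ha hb hab])
  have hxQ : g x ∈ P.image g := Finset.mem_image_of_mem g (by simp [hP])
  have hcoset_of_mem : ∀ y ∈ P, P = {y, y + a, y + b, y + (a + b)} := by
    intro y hy
    symm
    apply Finset.eq_of_subset_of_card_le _ (by rw [hPcard, card_plane _ ha hb hab])
    have h1 : a + (a + b) = b := by rw [← add_assoc, hself, zero_add]
    have h2 : b + (a + b) = a := by rw [add_left_comm, hself, add_zero]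
    intro z hz
    simp only [hP, Finset.mem_insert, Finset.mem_singleton] at hy hz ⊢
    rcases hy with rfl | rfl | rfl | rfl <;> rcases hz with rfl | rfl | rfl | rfl <;>
      simp [add_assoc, hself, h1, h2, add_comm b a]
  have hcard_add := card_symmDiff_add (P.image g) P
  rcases h with (h | ⟨φ, c, hφ, h⟩) | h
  · have hPQ : P.image g = P := by
      rwa [Set.mem_singleton_iff, Finset.coe_eq_empty, ← Finset.bot_eq_empty,
        symmDiff_eq_bot] at h
    rw [hPQ] at hxQ ⊢
    exact (hcoset_of_mem _ hxQ).ge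
  · have hcard : (symmDiff (P.image g) P).card = 8 := by
      rw [← Set.ncard_coe_finset, h, ncard_level hφ]
    have hinter : P.image g ∩ P = ∅ := by
      rw [← Finset.card_eq_zero]
      omega
    have hmem : ∀ y, φ y = c ↔ y ∈ P.image g ∨ y ∈ P := by
      intro y
      have h1 : y ∈ ((symmDiff (P.image g) P : Finset V) : Set V) ↔ φ y = c := by rw [h]; rfl
      rw [← h1, Finset.mem_coe, symmDiff_eq_sup_sdiff_inf, Finset.inf_eq_inter, hinter]
      simp
    have hx := (hmem x).2 (Or.inr (by simp [hP]))
    have hxa := (hmem (x + a)).2 (Or.inr (by simp [hP]))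
    have hxb := (hmem (x + b)).2 (Or.inr (by simp [hP]))
    have hφa : φ a = 0 := by simpa [hx] using hxa
    have hφb : φ b = 0 := by simpa [hx] using hxb
    have hgx := (hmem (g x)).2 (Or.inl hxQ)
    have hgx' : g x ∉ P := fun h' => by
      have : g x ∈ P.image g ∩ P := Finset.mem_inter.2 ⟨hxQ, h'⟩
      simp [hinter] at this
    intro y hy
    refine ((hmem y).1 ?_).resolve_right fun hyP => hgx' ?_
    · simp only [Finset.mem_insert, Finset.mem_singleton] at hy
      rcases hy with rfl | rfl | rfl | rfl <;> simp [hgx, hφa, hφb]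
    · rw [hcoset_of_mem y hyP]
      simp only [Finset.mem_insert, Finset.mem_singleton] at hy ⊢
      rcases hy with rfl | rfl | rfl | rfl <;> simp [add_assoc, hself]
  · exfalso
    have h16 : (symmDiff (P.image g) P).card = 16 := by
      rw [← Set.ncard_coe_finset, h, Set.ncard_univ]
      simp
    omega

lemma exists_translation {g : V → V} (hg : Function.Injective g)
    (h : ∀ S : Set V, EvenIntersecting S → symmDiff (g '' S) S ∈ Ostar) :
    ∃ t : V, ∀ x, g x = x + t := by
  classical
  have hself : ∀ y : V, y + y = 0 := ZModModule.add_self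
  have hcard : (Finset.univ : Finset V).card = 16 := by simp
  have hstep : ∀ x a, g (x + a) = g x + a := by
    intro x a
    rcases eq_or_ne a 0 with rfl | ha
    · simp
    obtain ⟨b, -, hb⟩ := Finset.exists_mem_notMem_of_card_lt_card
      (s := {0, a}) (t := (Finset.univ : Finset V)) (Finset.card_le_two.trans_lt (by omega))
    obtain ⟨c, -, hc⟩ := Finset.exists_mem_notMem_of_card_lt_card
      (s := {0, a, b, a + b}) (t := (Finset.univ : Finset V))
      (Finset.card_le_four.trans_lt (by omega))
    simp only [Finset.mem_insert, Finset.mem_singleton, not_or] at hb hc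
    have h1 := image_plane_parallel hg x ha hb.1 (Ne.symm hb.2)
      (h _ (evenIntersecting_plane x ha hb.1 (Ne.symm hb.2)))
    have h2 := image_plane_parallel hg x ha hc.1 (Ne.symm hc.2.1)
      (h _ (evenIntersecting_plane x ha hc.1 (Ne.symm hc.2.1)))
    obtain ⟨-, hca, hcb, hcab⟩ := hc
    rcases h1 with h1 | h1 | h1
    · exact h1
    all_goals
      rcases h2 with h2 | h2 | h2
      · exact h2
      all_goals
        have h3 := add_left_cancel (h1.symm.trans h2)
    · exact absurd h3.symm hcb
    · exact absurd (by rw [h3, ← add_assoc, hself, zero_add]) hcab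
    · exact absurd h3.symm hcab
    · exact absurd (add_left_cancel h3).symm hcb
  exact ⟨g 0, fun x => by simpa [add_comm] using hstep 0 x⟩

lemma IsAffineHyperplane.translate {H : Set V} (hH : IsAffineHyperplane H) (t : V) :
    IsAffineHyperplane ((fun x => x + t) '' H) := by
  obtain ⟨φ, c, hφ, rfl⟩ := hH
  refine ⟨φ, c - φ t, hφ, ?_⟩
  rw [image_add_const_eq]
  ext x
  simp [eq_sub_iff_add_eq]

lemma isKummerTranslation_iff (g : Equiv.Perm V) :
    IsKummerTranslation g ↔ ∃ t : V, ∀ x, g x = x + t := by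
  constructor
  · exact fun hg => exists_translation g.injective hg.2
  · rintro ⟨t, ht⟩
    have : (g : V → V) = fun x => x + t := funext ht
    unfold IsKummerTranslation
    rw [this]
    exact ⟨fun H hH => hH.translate t, fun S hS => hS.symmDiff_translate_mem_Ostar t⟩

/-- The homomorphism sending `t` to the translation `x ↦ x + t`. -/
def translationHom : Multiplicative V →* Equiv.Perm V where
  toFun t := Equiv.addRight t.toAdd
  map_one' := by ext; simp
  map_mul' s t := by
    refine Equiv.ext fun x => ?_
    simp [add_comm, add_left_comm]

lemma translationHom_injective : Function.Injective translationHom := by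
  intro s t h
  have := DFunLike.congr_fun h 0
  simpa [translationHom] using this

/-- for a bijection `g` preserving affine hyperplanes, the condition
`g(S) ∆ S ∈ O_*` for all even-intersecting `S` holds iff `g` is a translation; the set
of such bijections forms a group isomorphic to `(ℤ/2)⁴` acting simply transitively
on `V`. -/
theorem translations_characterization :
    (∀ g : V → V, Function.Bijective g →
      (∀ H : Set V, IsAffineHyperplane H → IsAffineHyperplane (g '' H)) →
      ((∀ S : Set V, EvenIntersecting S → symmDiff (g '' S) S ∈ Ostar) ↔
        ∃ t : V, ∀ x, g x = x + t)) ∧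
    (∃ G : Subgroup (Equiv.Perm V),
      (∀ g : Equiv.Perm V, g ∈ G ↔ IsKummerTranslation g) ∧
      Nonempty (G ≃* Multiplicative (Fin 4 → ZMod 2)) ∧
      (∀ x y : V, ∃! g : G, (g : Equiv.Perm V) x = y)) := by
  refine ⟨fun g hg _ => ⟨exists_translation hg.injective, ?_⟩, translationHom.range,
    fun g => ?_, ⟨(MonoidHom.ofInjective translationHom_injective).symm⟩, fun x y => ?_⟩
  · rintro ⟨t, ht⟩ S hS
    rw [funext ht]
    exact hS.symmDiff_translate_mem_Ostar t
  · rw [isKummerTranslation_iff]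
    constructor
    · rintro ⟨t, rfl⟩
      exact ⟨t.toAdd, fun x => rfl⟩
    · rintro ⟨t, ht⟩
      exact ⟨Multiplicative.ofAdd t, Equiv.ext fun x => (ht x).symm⟩
  · refine ⟨⟨translationHom (Multiplicative.ofAdd (y - x)), _, rfl⟩, ?_, ?_⟩
    · simp [translationHom]
    · rintro ⟨_, t, rfl⟩ h
      have : t = Multiplicative.ofAdd (y - x) := by
        rw [← h]
        simp [translationHom]
      exact Subtype.ext (congrArg translationHom this)
end

section
/- Suppose u ∈ Q is such that e₁, …, e₁₆, h, u are linearly independent, B(u, u) = −2, B(u, h) = ε, and B(u, eᵢ) ∈ {0, 1, 2} for all i; let p := |supp₁(u)| and q := |supp₂(u)|. Since B is nondegenerate on U := span(e₁, …, e₁₆, h), write u = u₀ + ũ with u₀ ∈ U and ũ orthogonal to U. Then 36·B(ũ, ũ) = −(p + 2q + ε)² + 18p + 72q − 72. -/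
/-- A function valued in `{0, 1, 2}` has its sum and its sum of squares determined by the sizes of the
level sets of `1` and `2`. -/
theorem sum_eq_ncard_of_mem_zero_one_two {ι : Type*} [Fintype ι] (x : ι → ℚ)
    (hx : ∀ i, x i = 0 ∨ x i = 1 ∨ x i = 2) :
    ∑ i, x i = ({i | x i = 1}.ncard : ℚ) + 2 * {i | x i = 2}.ncard ∧
      ∑ i, x i ^ 2 = ({i | x i = 1}.ncard : ℚ) + 4 * {i | x i = 2}.ncard := by
  classical
  have card_eq (c : ℚ) : ({i | x i = c}.ncard : ℚ) = ∑ i, if x i = c then 1 else 0 := by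
    rw [Set.ncard_eq_toFinset_card', Finset.sum_boole]
    simp
  rw [card_eq, card_eq, Finset.mul_sum, Finset.mul_sum, ← Finset.sum_add_distrib,
    ← Finset.sum_add_distrib]
  constructor <;> refine Finset.sum_congr rfl fun i _ => ?_ <;>
    rcases hx i with h | h | h <;> norm_num [h]

theorem exists_eq_sum_smul_add_smul_of_mem_span {K V ι : Type*} [Ring K] [AddCommGroup V]
    [Module K V] [Fintype ι] {e : ι → V} {h w : V}
    (hw : w ∈ Submodule.span K (Set.range e ∪ {h})) :
    ∃ (a : ι → K) (b : K), w = ∑ i, a i • e i + b • h := by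
  rw [Submodule.span_union, Submodule.mem_sup] at hw
  obtain ⟨y, hy, z, hz, rfl⟩ := hw
  obtain ⟨a, rfl⟩ := (Submodule.mem_span_range_iff_exists_fun K).1 hy
  obtain ⟨b, rfl⟩ := Submodule.mem_span_singleton.1 hz
  exact ⟨a, b, rfl⟩


/-- writing `u = u₀ + uTil` with `u₀` in `U := span(e₁,…,e₁₆,h)` and `uTil`
orthogonal to `U`, and setting `p := |supp₁(u)|`, `q := |supp₂(u)|`, one has
`36·B(uTil,uTil) = −(p + 2q + ε)² + 18p + 72q − 72`. -/
theorem sylvester_projection_formula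
    (Q : Type*) [AddCommGroup Q] [Module ℚ Q]
    (B : Q →ₗ[ℚ] Q →ₗ[ℚ] ℚ) (hsymm : ∀ x y, B x y = B y x)
    (e : Fin 16 → Q) (h : Q) (u : Q)
    (hind : LinearIndependent ℚ (Fin.snoc (Fin.snoc e h) u : Fin 18 → Q))
    (hee : ∀ i j, B (e i) (e j) = if i = j then -2 else 0)
    (hhh : B h h = 4) (hhe : ∀ i, B h (e i) = 2)
    (huu : B u u = -2) (ε : ℚ) (huh : B u h = ε)
    (hue : ∀ i, B u (e i) = 0 ∨ B u (e i) = 1 ∨ B u (e i) = 2)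
    (p q : ℕ)
    (hp : p = {i : Fin 16 | B u (e i) = 1}.ncard)
    (hq : q = {i : Fin 16 | B u (e i) = 2}.ncard)
    (u₀ uTil : Q)
    (hu₀ : u₀ ∈ Submodule.span ℚ (Set.range e ∪ {h}))
    (huTil : ∀ x ∈ Submodule.span ℚ (Set.range e ∪ {h}), B uTil x = 0)
    (hdecomp : u = u₀ + uTil) :
    36 * B uTil uTil = -((p : ℚ) + 2 * q + ε) ^ 2 + 18 * p + 72 * q - 72 := by
  obtain ⟨hsum, hsq⟩ := sum_eq_ncard_of_mem_zero_one_two (fun i => B u (e i)) hue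
  rw [← hp, ← hq] at hsum hsq
  have perp_e (i : Fin 16) : B uTil (e i) = 0 := huTil _ (Submodule.subset_span (by simp))
  have perp_h : B uTil h = 0 := huTil _ (Submodule.subset_span (by simp))
  have perp_u₀ : B uTil u₀ = 0 := huTil _ hu₀
  obtain ⟨a, b, hab⟩ := exists_eq_sum_smul_add_smul_of_mem_span hu₀
  have pair_e (i : Fin 16) : B u (e i) = -2 * a i + 2 * b := by
    rw [hdecomp, map_add, LinearMap.add_apply, perp_e, hab]
    simp [hee, hhe]
    ring
  have pair_h : ε = 2 * ∑ i, a i + 4 * b := by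
    rw [← huh, hdecomp, map_add, LinearMap.add_apply, perp_h, hab]
    simp [hsymm _ h, hhe, hhh, Finset.sum_mul, mul_comm]
  have pair_u₀ : B u u₀ = ∑ i, a i * B u (e i) + b * ε := by
    rw [hab]
    simp [huh]
  have norm_uTil : B uTil uTil = B u u - B u u₀ := by
    have : uTil = u - u₀ := by rw [hdecomp]; abel
    calc B uTil uTil = B uTil u := by rw [hdecomp, map_add, perp_u₀, zero_add]
      _ = B u uTil := hsymm _ _
      _ = B u u - B u u₀ := by rw [this, map_sub]
  have coeff (i : Fin 16) : a i = b - B u (e i) / 2 := by linarith [pair_e i]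
  have sum_coeff : ∑ i, a i = 16 * b - (p + 2 * q) / 2 := by
    simp_rw [coeff, Finset.sum_sub_distrib, ← Finset.sum_div, hsum]
    simp
  have sum_pair : ∑ i, a i * B u (e i) = b * (p + 2 * q) - (p + 4 * q) / 2 := by
    rw [← hsum, ← hsq, Finset.mul_sum, Finset.sum_div, ← Finset.sum_sub_distrib]
    refine Finset.sum_congr rfl fun i _ => ?_
    rw [coeff]
    ring
  have hb : b = (p + 2 * q + ε) / 36 := by linarith
  rw [norm_uTil, huu, pair_u₀, sum_pair, hb]
  ring
end

section
/- Let u ∈ Q satisfy B(u, u) = −2, B(u, h) = ε with ε ∈ {1, 2}, and B(u, eᵢ) ∈ {0, 1, 2} for all i, with supp₁(u) = 𝔲 and supp₂(u) = 𝔲̈ (disjoint subsets of {1, …, 16}). Then for every subset σ ⊆ {1, …, 16} ∖ 𝔲 with |σ| = |𝔲̈|, the vector v := u + e_{𝔲̈∖σ} − e_{σ∖𝔲̈} satisfies B(v, v) = −2, B(v, h) = ε, supp₁(v) = 𝔲, supp₂(v) = σ, and B(v, eᵢ) = 0 for all i ∉ 𝔲 ∪ σ. -/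
/-- moving the 2-support of an extra line/conic. Given `u` with
`supp₁(u) = 𝔲`, `supp₂(u) = 𝔲̈` and a set `σ` disjoint from `𝔲` with `|σ| = |𝔲̈|`,
the vector `v := u + e_{𝔲̈∖σ} − e_{σ∖𝔲̈}` satisfies `B(v,v) = −2`, `B(v,h) = ε`,
`supp₁(v) = 𝔲`, `supp₂(v) = σ` and `B(v,eᵢ) = 0` elsewhere. -/
theorem move_support
    (Q : Type*) [AddCommGroup Q] [Module ℚ Q]
    (B : Q →ₗ[ℚ] Q →ₗ[ℚ] ℚ) (hsymm : ∀ x y, B x y = B y x)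
    (e : Fin 16 → Q) (h : Q)
    (hind : LinearIndependent ℚ (Fin.snoc e h : Fin 17 → Q))
    (hee : ∀ i j, B (e i) (e j) = if i = j then -2 else 0)
    (hhh : B h h = 4) (hhe : ∀ i, B h (e i) = 2)
    (u : Q) (ε : ℚ) (hε : ε = 1 ∨ ε = 2)
    (huu : B u u = -2) (huh : B u h = ε)
    (s1 s2 σ : Finset (Fin 16))
    (hdisj : Disjoint s1 s2)
    (hσ : Disjoint σ s1) (hcard : σ.card = s2.card)
    (hsupp : ∀ i, B u (e i) = if i ∈ s1 then 1 else if i ∈ s2 then 2 else 0) :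
    B (u + ∑ i ∈ s2 \ σ, e i - ∑ i ∈ σ \ s2, e i)
      (u + ∑ i ∈ s2 \ σ, e i - ∑ i ∈ σ \ s2, e i) = -2 ∧
    B (u + ∑ i ∈ s2 \ σ, e i - ∑ i ∈ σ \ s2, e i) h = ε ∧
    (∀ i, B (u + ∑ i ∈ s2 \ σ, e i - ∑ i ∈ σ \ s2, e i) (e i) =
      if i ∈ s1 then 1 else if i ∈ σ then 2 else 0) := by
  have hcard' : (((σ \ s2).card : ℕ) : ℚ) = ((s2 \ σ).card : ℕ) := by
    exact_mod_cast Finset.card_sdiff_comm hcard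
  have hsum_e : ∀ (T : Finset (Fin 16)) (i : Fin 16),
      B (∑ j ∈ T, e j) (e i) = if i ∈ T then -2 else 0 := by
    intro T i
    simp [map_sum, LinearMap.sum_apply, hee]
  have hsum_h : ∀ T : Finset (Fin 16), B (∑ j ∈ T, e j) h = T.card * 2 := by
    intro T
    simp [map_sum, LinearMap.sum_apply, hsymm _ h, hhe]
  have hve : ∀ i, B (u + ∑ i ∈ s2 \ σ, e i - ∑ i ∈ σ \ s2, e i) (e i) =
      if i ∈ s1 then 1 else if i ∈ σ then 2 else 0 := by
    intro i
    have h12 : i ∈ s1 → i ∉ s2 := fun hi => Finset.disjoint_left.mp hdisj hi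
    have h1σ : i ∈ s1 → i ∉ σ := fun hi => Finset.disjoint_right.mp hσ hi
    simp only [map_sub, map_add, LinearMap.sub_apply, LinearMap.add_apply, hsum_e, hsupp,
      Finset.mem_sdiff]
    by_cases hi1 : i ∈ s1
    · simp [hi1, h12 hi1, h1σ hi1]
    · by_cases hi2 : i ∈ s2 <;> by_cases hiσ : i ∈ σ <;> simp [hi1, hi2, hiσ]
  have hu_a : B u (∑ i ∈ s2 \ σ, e i) = (s2 \ σ).card * 2 := by
    rw [map_sum, Finset.sum_congr rfl (g := fun _ => (2 : ℚ)), Finset.sum_const, nsmul_eq_mul]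
    intro i hi
    have hi2 := (Finset.mem_sdiff.mp hi).1
    simp [hsupp, hi2, Finset.disjoint_right.mp hdisj hi2]
  have hu_b : B u (∑ i ∈ σ \ s2, e i) = 0 := by
    rw [map_sum]
    refine Finset.sum_eq_zero fun i hi => ?_
    obtain ⟨hiσ, hi2⟩ := Finset.mem_sdiff.mp hi
    simp [hsupp, hi2, Finset.disjoint_left.mp hσ hiσ]
  have hv_a : B (u + ∑ i ∈ s2 \ σ, e i - ∑ i ∈ σ \ s2, e i) (∑ i ∈ s2 \ σ, e i) = 0 := by
    rw [map_sum]
    refine Finset.sum_eq_zero fun i hi => ?_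
    obtain ⟨hi2, hiσ⟩ := Finset.mem_sdiff.mp hi
    simp [-map_sub, -map_add, hve, hiσ, Finset.disjoint_right.mp hdisj hi2]
  have hv_b : B (u + ∑ i ∈ s2 \ σ, e i - ∑ i ∈ σ \ s2, e i) (∑ i ∈ σ \ s2, e i) =
      (σ \ s2).card * 2 := by
    rw [map_sum, Finset.sum_congr rfl (g := fun _ => (2 : ℚ)), Finset.sum_const, nsmul_eq_mul]
    intro i hi
    have hiσ := (Finset.mem_sdiff.mp hi).1
    simp [-map_sub, -map_add, hve, hiσ, Finset.disjoint_left.mp hσ hiσ]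
  refine ⟨?_, ?_, hve⟩
  · rw [map_sub, map_add, hv_a, hv_b, hsymm _ u, map_sub, map_add, huu, hu_a, hu_b, hcard']
    ring
  · simp only [map_sub, map_add, LinearMap.sub_apply, LinearMap.add_apply, hsum_h, huh, hcard']
    ring
end

section
/- Let u ∈ Q satisfy B(u, u) = −2, B(u, h) = 1, and B(u, eᵢ) = 1 for all i in an 8-element subset 𝔲 ⊆ {1, …, 16} and B(u, eᵢ) = 0 for i ∉ 𝔲. Then the vector v := 2u + ½·e_𝔲 − ½·e_{𝔲̄}, where 𝔲̄ := {1, …, 16} ∖ 𝔲, satisfies B(v, v) = 0 and B(v, h) = 2. (This produces a 2-isotropic vector and hence shows that an extra line supported on an 8-element set yields a non-admissible lattice.) -/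
/-- for an extra line `u` (`B(u,u) = −2`, `B(u,h) = 1`) supported on an
8-element set `𝔲` (with `B(u,eᵢ) = 1` for `i ∈ 𝔲` and `0` otherwise), the vector
`v := 2u + ½·e_𝔲 − ½·e_𝔲̄` satisfies `B(v,v) = 0` and `B(v,h) = 2`
(a 2-isotropic vector). -/
theorem two_isotropic_vector
    (Q : Type*) [AddCommGroup Q] [Module ℚ Q]
    (B : Q →ₗ[ℚ] Q →ₗ[ℚ] ℚ) (hsymm : ∀ x y, B x y = B y x)
    (e : Fin 16 → Q) (h : Q)
    (hind : LinearIndependent ℚ (Fin.snoc e h : Fin 17 → Q))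
    (hee : ∀ i j, B (e i) (e j) = if i = j then -2 else 0)
    (hhh : B h h = 4) (hhe : ∀ i, B h (e i) = 2)
    (u : Q) (huu : B u u = -2) (huh : B u h = 1)
    (s : Finset (Fin 16)) (hs : s.card = 8)
    (hsupp : ∀ i, B u (e i) = if i ∈ s then 1 else 0) :
    B ((2 : ℚ) • u + (1/2 : ℚ) • ∑ i ∈ s, e i - (1/2 : ℚ) • ∑ i ∈ sᶜ, e i)
      ((2 : ℚ) • u + (1/2 : ℚ) • ∑ i ∈ s, e i - (1/2 : ℚ) • ∑ i ∈ sᶜ, e i) = 0 ∧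
    B ((2 : ℚ) • u + (1/2 : ℚ) • ∑ i ∈ s, e i - (1/2 : ℚ) • ∑ i ∈ sᶜ, e i) h = 2 := by
  have hsc : sᶜ.card = 8 := by rw [Finset.card_compl, hs, Fintype.card_fin]
  have hee' (a b : Finset (Fin 16)) :
      B (∑ i ∈ a, e i) (∑ i ∈ b, e i) = -2 * (a ∩ b).card := by
    simp only [map_sum, LinearMap.sum_apply, hee, Finset.sum_ite_eq', Finset.sum_ite_mem,
      Finset.sum_const, nsmul_eq_mul]
    rw [Finset.inter_comm, mul_comm]
  have hue (a : Finset (Fin 16)) : B u (∑ i ∈ a, e i) = (a ∩ s).card := by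
    simp [map_sum, hsupp]
  have heh (a : Finset (Fin 16)) : B (∑ i ∈ a, e i) h = 2 * a.card := by
    rw [hsymm]
    simp [map_sum, hhe, mul_comm]
  have hsu : s ∩ sᶜ = ∅ := Finset.inter_compl s
  have hus : sᶜ ∩ s = ∅ := by rw [Finset.inter_comm, hsu]
  constructor
  · simp only [map_add, map_sub, map_smul, LinearMap.add_apply, LinearMap.sub_apply,
      LinearMap.smul_apply, smul_eq_mul, hsymm _ u, hee', hue, huu, hsu, hus,
      Finset.inter_self, hs, hsc, Finset.card_empty]
    norm_num
  · simp only [map_add, map_sub, map_smul, LinearMap.add_apply, LinearMap.sub_apply,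
      LinearMap.smul_apply, smul_eq_mul, heh, huh, hs, hsc]
    norm_num
end

section
/- The Mukai quartic z₀⁴ + z₁⁴ + z₂⁴ + z₃⁴ + 12·z₀z₁z₂z₃ = 0 is a smooth surface in ℙ³(ℂ): if (z₀, z₁, z₂, z₃) ∈ ℂ⁴ satisfies all four equations 4z₀³ + 12z₁z₂z₃ = 0, 4z₁³ + 12z₀z₂z₃ = 0, 4z₂³ + 12z₀z₁z₃ = 0, and 4z₃³ + 12z₀z₁z₂ = 0, then z₀ = z₁ = z₂ = z₃ = 0. -/
/-- the Mukai quartic `z₀⁴ + z₁⁴ + z₂⁴ + z₃⁴ + 12·z₀z₁z₂z₃ = 0` is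
smooth: the only common zero in `ℂ⁴` of the four partial derivatives of
`F = z₀⁴ + z₁⁴ + z₂⁴ + z₃⁴ + 12·z₀z₁z₂z₃` is the origin. -/
theorem mukai_quartic_smooth
    (z₀ z₁ z₂ z₃ : ℂ)
    (h₀ : 4 * z₀ ^ 3 + 12 * z₁ * z₂ * z₃ = 0)
    (h₁ : 4 * z₁ ^ 3 + 12 * z₀ * z₂ * z₃ = 0)
    (h₂ : 4 * z₂ ^ 3 + 12 * z₀ * z₁ * z₃ = 0)
    (h₃ : 4 * z₃ ^ 3 + 12 * z₀ * z₁ * z₂ = 0) :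
    z₀ = 0 ∧ z₁ = 0 ∧ z₂ = 0 ∧ z₃ = 0 := by
  have e₀ : z₀ ^ 4 = -3 * (z₀ * z₁ * z₂ * z₃) := by linear_combination z₀ / 4 * h₀
  have e₁ : z₁ ^ 4 = -3 * (z₀ * z₁ * z₂ * z₃) := by linear_combination z₁ / 4 * h₁
  have e₂ : z₂ ^ 4 = -3 * (z₀ * z₁ * z₂ * z₃) := by linear_combination z₂ / 4 * h₂
  have e₃ : z₃ ^ 4 = -3 * (z₀ * z₁ * z₂ * z₃) := by linear_combination z₃ / 4 * h₃
  have hprod : z₀ * z₁ * z₂ * z₃ = 0 := by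
    have h : (z₀ * z₁ * z₂ * z₃) ^ 4 = 81 * (z₀ * z₁ * z₂ * z₃) ^ 4 := by
      calc (z₀ * z₁ * z₂ * z₃) ^ 4 = z₀ ^ 4 * z₁ ^ 4 * z₂ ^ 4 * z₃ ^ 4 := by ring
        _ = 81 * (z₀ * z₁ * z₂ * z₃) ^ 4 := by rw [e₀, e₁, e₂, e₃]; ring
    refine eq_zero_of_pow_eq_zero (n := 4) ?_
    linear_combination (-1 / 80) * h
  rw [hprod, mul_zero] at e₀ e₁ e₂ e₃
  exact ⟨eq_zero_of_pow_eq_zero e₀, eq_zero_of_pow_eq_zero e₁,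
    eq_zero_of_pow_eq_zero e₂, eq_zero_of_pow_eq_zero e₃⟩
end
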